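/- arXiv:1510.02848 — 2 statements merged into one kernel-verified Lean document; each statement's English description precedes it below -/
import Mathlib

section
/- Let γ ∈ ℂ_0^E be such that (L_γ)_{II} is invertible, let δγ ∈ ℂ^E, let u_B, v_B ∈ ℂ^B, and let u, v ∈ ℂ^V be the unique (γ,0)-harmonic functions with boundary values u_B and v_B respectively. Then the function t ↦ u_B^T Λ_{γ + tδγ, 0} v_B, defined for complex t in a neighborhood of 0, is differentiable at t = 0 with derivative (δγ)^T [(∇u) ⊙ (∇v)]. -/
/-!
Common setup: a finite graph whose vertex set is partitioned into boundary
nodes `B` and interior nodes `I` (so the vertex set is `B ⊕ I`), with edge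
set `E` and a fixed orientation given by maps `head tail : E → B ⊕ I`.
-/

open Matrix MeasureTheory

namespace DIP

noncomputable section

variable {B I E : Type*} [Fintype B] [Fintype I] [Fintype E]
  [DecidableEq B] [DecidableEq I] [DecidableEq E]

/-- Discrete gradient: `(∇u)(e) = u(head e) - u(tail e)`. -/
def grad (head tail : E → B ⊕ I) (u : B ⊕ I → ℂ) : E → ℂ :=
  fun e => u (head e) - u (tail e)

/-- Signed incidence matrix over a commutative ring `α`. -/
def incMat (α : Type*) [CommRing α] (head tail : E → B ⊕ I) : Matrix E (B ⊕ I) α :=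
  Matrix.of fun e v => (if v = head e then (1 : α) else 0) - (if v = tail e then (1 : α) else 0)

/-- Weighted graph Laplacian `L_γ = ∇ᵀ diag(γ) ∇`. -/
def lap (α : Type*) [CommRing α] (head tail : E → B ⊕ I) (γ : E → α) :
    Matrix (B ⊕ I) (B ⊕ I) α :=
  (incMat α head tail)ᵀ * Matrix.diagonal γ * incMat α head tail

/-- The `II` block of the weighted graph Laplacian. -/
def lapII (α : Type*) [CommRing α] (head tail : E → B ⊕ I) (γ : E → α) : Matrix I I α :=
  (lap α head tail γ).submatrix Sum.inr Sum.inr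

/-- The `IB` block of the weighted graph Laplacian. -/
def lapIB (α : Type*) [CommRing α] (head tail : E → B ⊕ I) (γ : E → α) : Matrix I B α :=
  (lap α head tail γ).submatrix Sum.inr Sum.inl

/-- The `BI` block of the weighted graph Laplacian. -/
def lapBI (α : Type*) [CommRing α] (head tail : E → B ⊕ I) (γ : E → α) : Matrix B I α :=
  (lap α head tail γ).submatrix Sum.inl Sum.inr

/-- The `BB` block of the weighted graph Laplacian. -/
def lapBB (α : Type*) [CommRing α] (head tail : E → B ⊕ I) (γ : E → α) : Matrix B B α :=
  (lap α head tail γ).submatrix Sum.inl Sum.inl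

/-- Dirichlet-to-Neumann map
`Λ_{γ,q} = (L_γ)_BB - (L_γ)_BI [(L_γ)_II + diag(q)]⁻¹ (L_γ)_IB`. -/
def dtn (head tail : E → B ⊕ I) (γ : E → ℂ) (q : I → ℂ) : Matrix B B ℂ :=
  lapBB ℂ head tail γ -
    lapBI ℂ head tail γ * (lapII ℂ head tail γ + Matrix.diagonal q)⁻¹ * lapIB ℂ head tail γ

/-- `u` is `(γ,q)`-harmonic: `(L_γ u)_I + q ⊙ u_I = 0`. -/
def Harmonic (head tail : E → B ⊕ I) (γ : E → ℂ) (q : I → ℂ) (u : B ⊕ I → ℂ) : Prop :=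
  ∀ i : I, (lap ℂ head tail γ).mulVec u (Sum.inr i) + q i * u (Sum.inr i) = 0

/-- The graph `G` is connected. -/
def Gconn (head tail : E → B ⊕ I) : Prop :=
  (SimpleGraph.fromRel fun v w : B ⊕ I => ∃ e, head e = v ∧ tail e = w).Connected

/-- The subgraph of `G` induced on the interior nodes is connected. -/
def GIconn (head tail : E → B ⊕ I) : Prop :=
  (SimpleGraph.fromRel fun i j : I => ∃ e, head e = Sum.inr i ∧ tail e = Sum.inr j).Connected

/-- `P(γ₁,γ₂)`: span of Hadamard products of gradients of harmonic functions. -/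
def Pspace (head tail : E → B ⊕ I) (γ₁ γ₂ : E → ℂ) : Submodule ℂ (E → ℂ) :=
  Submodule.span ℂ { w : E → ℂ | ∃ u v : B ⊕ I → ℂ,
    Harmonic head tail γ₁ 0 u ∧ Harmonic head tail γ₂ 0 v ∧
    w = fun e => grad head tail u e * grad head tail v e }

/-- `Q(q₁,q₂)`: span of Hadamard products of interior values of harmonic functions. -/
def Qspace (head tail : E → B ⊕ I) (γ : E → ℂ) (q₁ q₂ : I → ℂ) : Submodule ℂ (I → ℂ) :=
  Submodule.span ℂ { w : I → ℂ | ∃ u v : B ⊕ I → ℂ,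
    Harmonic head tail γ q₁ u ∧ Harmonic head tail γ q₂ v ∧
    w = fun i => u (Sum.inr i) * v (Sum.inr i) }

/-- The matrix `U(γ)` whose `i`-th column is the harmonic extension of the
standard basis vector `e_i ∈ ℂ^B`. -/
def Usol (head tail : E → B ⊕ I) (γ : E → ℂ) : Matrix (B ⊕ I) B ℂ :=
  Matrix.of (Sum.elim (fun b i => if b = i then (1 : ℂ) else 0)
    (fun j i => (-((lapII ℂ head tail γ)⁻¹ * lapIB ℂ head tail γ)) j i))

/-- The products-of-gradients matrix `F(γ₁,γ₂) ∈ ℂ^{|E| × |B|²}` whose column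
indexed by `(i,j)` is `(∇ U(γ₁))_{:,i} ⊙ (∇ U(γ₂))_{:,j}`. -/
def Fmat (head tail : E → B ⊕ I) (γ₁ γ₂ : E → ℂ) : Matrix E (B × B) ℂ :=
  Matrix.of fun e p =>
    grad head tail (fun v => Usol head tail γ₁ v p.1) e *
    grad head tail (fun v => Usol head tail γ₂ v p.2) e

/-- Smallest eigenvalue of a real symmetric matrix, as the minimum of its
Rayleigh quotient over the (Euclidean) unit sphere. -/
def lambdaMin (M : Matrix I I ℝ) : ℝ :=
  ⨅ x : { x : I → ℝ // ∑ i, x i ^ 2 = 1 }, (x : I → ℝ) ⬝ᵥ M.mulVec (x : I → ℝ)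


theorem incMat_mulVec (head tail : E → B ⊕ I) (x : B ⊕ I → ℂ) :
    (incMat ℂ head tail) *ᵥ x = grad head tail x := by
  ext e
  simp [incMat, grad, Matrix.mulVec, dotProduct, sub_mul, Finset.sum_sub_distrib]

theorem quad_lap (head tail : E → B ⊕ I) (γ : E → ℂ) (x y : B ⊕ I → ℂ) :
    x ⬝ᵥ (lap ℂ head tail γ) *ᵥ y = ∑ e, γ e * (grad head tail x e * grad head tail y e) := by
  rw [lap, ← Matrix.mulVec_mulVec, ← Matrix.mulVec_mulVec, incMat_mulVec,
    Matrix.dotProduct_mulVec, Matrix.vecMul_transpose, incMat_mulVec]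
  simp only [dotProduct, Matrix.mulVec_diagonal]
  exact Finset.sum_congr rfl fun e _ => by ring

/-- harmonic extension -/
def ext (head tail : E → B ⊕ I) (γ : E → ℂ) (vB : B → ℂ) : B ⊕ I → ℂ :=
  Sum.elim vB (-((lapII ℂ head tail γ)⁻¹ *ᵥ (lapIB ℂ head tail γ *ᵥ vB)))

theorem lap_mulVec_inr (head tail : E → B ⊕ I) (γ : E → ℂ) (w : B ⊕ I → ℂ) (i : I) :
    (lap ℂ head tail γ *ᵥ w) (Sum.inr i) =
      (lapIB ℂ head tail γ *ᵥ (fun b => w (Sum.inl b)) +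
        lapII ℂ head tail γ *ᵥ (fun j => w (Sum.inr j))) i := by
  simp [Matrix.mulVec, dotProduct, lapIB, lapII, Fintype.sum_sum_type]

theorem lap_mulVec_inl (head tail : E → B ⊕ I) (γ : E → ℂ) (w : B ⊕ I → ℂ) (b : B) :
    (lap ℂ head tail γ *ᵥ w) (Sum.inl b) =
      (lapBB ℂ head tail γ *ᵥ (fun b => w (Sum.inl b)) +
        lapBI ℂ head tail γ *ᵥ (fun j => w (Sum.inr j))) b := by
  simp [Matrix.mulVec, dotProduct, lapBB, lapBI, Fintype.sum_sum_type]

theorem ext_harm (head tail : E → B ⊕ I) (γ : E → ℂ) (vB : B → ℂ)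
    (h : IsUnit (lapII ℂ head tail γ)) (i : I) :
    (lap ℂ head tail γ *ᵥ (ext head tail γ vB)) (Sum.inr i) = 0 := by
  rw [lap_mulVec_inr]
  have hd := (Matrix.isUnit_iff_isUnit_det _).1 h
  simp only [ext, Sum.elim_inl, Sum.elim_inr]
  have : (fun j => (-((lapII ℂ head tail γ)⁻¹ *ᵥ (lapIB ℂ head tail γ *ᵥ vB))) j) =
    -((lapII ℂ head tail γ)⁻¹ *ᵥ (lapIB ℂ head tail γ *ᵥ vB)) := rfl
  rw [this, Matrix.mulVec_neg, Matrix.mulVec_mulVec, Matrix.mul_nonsing_inv _ hd]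
  simp

theorem dtn_eq (head tail : E → B ⊕ I) (γ : E → ℂ) (vB : B → ℂ) (u : B ⊕ I → ℂ)
    (h : IsUnit (lapII ℂ head tail γ)) :
    (fun b => u (Sum.inl b)) ⬝ᵥ (dtn head tail γ 0) *ᵥ vB =
      u ⬝ᵥ (lap ℂ head tail γ *ᵥ (ext head tail γ vB)) := by
  conv_rhs => rw [dotProduct, Fintype.sum_sum_type]
  simp only [ext_harm _ _ _ _ h, mul_zero, Finset.sum_const_zero, add_zero]
  rw [dotProduct]
  refine Finset.sum_congr rfl fun b _ => ?_
  rw [lap_mulVec_inl]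
  have : (fun j => ext head tail γ vB (Sum.inr j)) =
    -((lapII ℂ head tail γ)⁻¹ *ᵥ (lapIB ℂ head tail γ *ᵥ vB)) := rfl
  rw [this]
  have : (fun j => ext head tail γ vB (Sum.inl j)) = vB := rfl
  rw [this, dtn]
  have h0 : Matrix.diagonal (0 : I → ℂ) = 0 := Matrix.diagonal_zero
  rw [h0, add_zero, Matrix.sub_mulVec, Matrix.mulVec_neg, Matrix.mulVec_mulVec,
    Matrix.mulVec_mulVec, ← sub_eq_add_neg, Matrix.mul_assoc]

theorem ext_unique (head tail : E → B ⊕ I) (γ : E → ℂ) (v : B ⊕ I → ℂ)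
    (h : IsUnit (lapII ℂ head tail γ)) (hv : Harmonic head tail γ 0 v) :
    ext head tail γ (fun b => v (Sum.inl b)) = v := by
  have hd := (Matrix.isUnit_iff_isUnit_det _).1 h
  have h1 : lapIB ℂ head tail γ *ᵥ (fun b => v (Sum.inl b)) =
      -(lapII ℂ head tail γ *ᵥ (fun j => v (Sum.inr j))) := by
    ext i
    have := hv i
    rw [lap_mulVec_inr] at this
    simp only [Pi.add_apply, Pi.zero_apply, zero_mul, add_zero] at this
    exact eq_neg_of_add_eq_zero_left this
  ext x
  rcases x with b | i
  · rfl
  · simp only [ext, Sum.elim_inr]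
    rw [h1, Matrix.mulVec_neg, Matrix.mulVec_mulVec, Matrix.nonsing_inv_mul _ hd]
    simp

theorem lap_cont (head tail : E → B ⊕ I) (γ δγ : E → ℂ) :
    Continuous fun t : ℂ => lap ℂ head tail (fun e => γ e + t * δγ e) := by
  unfold lap
  have : Continuous fun t : ℂ => (fun e => γ e + t * δγ e) := by fun_prop
  exact (continuous_const.matrix_mul this.matrix_diagonal).matrix_mul continuous_const

theorem lapII_cont (head tail : E → B ⊕ I) (γ δγ : E → ℂ) :
    Continuous fun t : ℂ => lapII ℂ head tail (fun e => γ e + t * δγ e) :=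
  (lap_cont head tail γ δγ).matrix_submatrix _ _

theorem lapIB_cont (head tail : E → B ⊕ I) (γ δγ : E → ℂ) :
    Continuous fun t : ℂ => lapIB ℂ head tail (fun e => γ e + t * δγ e) :=
  (lap_cont head tail γ δγ).matrix_submatrix _ _

theorem ext_cont (head tail : E → B ⊕ I) (γ δγ : E → ℂ) (vB : B → ℂ)
    (h : IsUnit (lapII ℂ head tail γ)) (x : B ⊕ I) :
    ContinuousAt (fun t : ℂ => ext head tail (fun e => γ e + t * δγ e) vB x) 0 := by
  rcases x with b | i
  · exact continuousAt_const
  · have hd := ((Matrix.isUnit_iff_isUnit_det _).1 h).ne_zero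
    have hc := lapII_cont head tail γ δγ
    have hb := lapIB_cont head tail γ δγ
    have e : (fun t : ℂ => ext head tail (fun e => γ e + t * δγ e) vB (Sum.inr i)) =
      fun t : ℂ => -(((lapII ℂ head tail (fun e => γ e + t * δγ e)).det)⁻¹ *
        ((lapII ℂ head tail (fun e => γ e + t * δγ e)).adjugate *ᵥ
          (lapIB ℂ head tail (fun e => γ e + t * δγ e) *ᵥ vB)) i) := by
      ext t
      simp [ext, Matrix.inv_def, Matrix.smul_mulVec]
    rw [e]
    refine ((hc.matrix_det.continuousAt.inv₀ ?_).mul ?_).neg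
    · simpa using hd
    · exact ((continuous_apply i).comp
        (hc.matrix_adjugate.matrix_mulVec (hb.matrix_mulVec continuous_const))).continuousAt

/-- `t ↦ u_Bᵀ Λ_{γ + tδγ, 0} v_B` is differentiable at `t = 0`
with derivative `(δγ)ᵀ [(∇u) ⊙ (∇v)]`. -/
theorem linearization_cond [Nonempty B] (head tail : E → B ⊕ I)
    (γ : E → ℂ) (hγ : ∀ e, 0 < (γ e).re) (hinv : IsUnit (lapII ℂ head tail γ))
    (δγ : E → ℂ) (uB vB : B → ℂ) (u v : B ⊕ I → ℂ)
    (hu : Harmonic head tail γ 0 u) (huB : ∀ b, u (Sum.inl b) = uB b)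
    (hv : Harmonic head tail γ 0 v) (hvB : ∀ b, v (Sum.inl b) = vB b) :
    HasDerivAt (fun t : ℂ => uB ⬝ᵥ (dtn head tail (fun e => γ e + t * δγ e) 0).mulVec vB)
      (δγ ⬝ᵥ fun e => grad head tail u e * grad head tail v e) 0 := by
  obtain rfl : (fun b => u (Sum.inl b)) = uB := funext huB
  obtain rfl : (fun b => v (Sum.inl b)) = vB := funext hvB
  set W : ℂ → B ⊕ I → ℂ :=
    fun t => ext head tail (fun e => γ e + t * δγ e) (fun b => v (Sum.inl b)) with hW
  set g : ℂ → ℂ := fun t => ∑ e, δγ e * (grad head tail u e * grad head tail (W t) e) with hg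
  set c : ℂ := ∑ b, v (Sum.inl b) * (lap ℂ head tail γ *ᵥ u) (Sum.inl b) with hcdef
  have hW0 : W 0 = v := by
    simp only [hW, zero_mul, add_zero]
    exact ext_unique head tail γ v hinv hv
  have hgc : ContinuousAt g 0 := by
    have hx := ext_cont head tail γ δγ (fun b => v (Sum.inl b)) hinv
    refine tendsto_finsetSum _ fun e _ => ?_
    exact continuousAt_const.mul (continuousAt_const.mul ((hx (head e)).sub (hx (tail e))))
  have hc : ∀ t, ∑ e, γ e * (grad head tail u e * grad head tail (W t) e) = c := by
    intro t
    have h1 := quad_lap head tail γ (W t) u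
    rw [dotProduct, Fintype.sum_sum_type] at h1
    have h2 : ∀ i, (lap ℂ head tail γ *ᵥ u) (Sum.inr i) = 0 := fun i => by
      simpa using hu i
    simp only [h2, mul_zero, Finset.sum_const_zero, add_zero] at h1
    rw [hcdef]
    refine Eq.trans ?_ h1.symm
    exact Finset.sum_congr rfl fun e _ => by ring
  have hev : (fun t : ℂ => (fun b => u (Sum.inl b)) ⬝ᵥ
      (dtn head tail (fun e => γ e + t * δγ e) 0).mulVec (fun b => v (Sum.inl b)))
      =ᶠ[nhds 0] fun t => c + t * g t := by
    have hd := ((Matrix.isUnit_iff_isUnit_det _).1 hinv).ne_zero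
    have hne := (lapII_cont head tail γ δγ).matrix_det.continuousAt.eventually_ne
      (x := 0) (y := 0) (by simpa using hd)
    filter_upwards [hne] with t ht
    rw [dtn_eq _ _ _ _ u ((Matrix.isUnit_iff_isUnit_det _).2 (isUnit_iff_ne_zero.2 ht)),
      quad_lap, ← hc t, hg, Finset.mul_sum, ← Finset.sum_add_distrib]
    exact Finset.sum_congr rfl fun e _ => by simp only [hW]; ring
  refine HasDerivAt.congr_of_eventuallyEq ?_ hev
  have hg0 : (δγ ⬝ᵥ fun e => grad head tail u e * grad head tail v e) = g 0 := by
    simp only [hg, hW0, dotProduct]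
  rw [hg0, hasDerivAt_iff_tendsto_slope]
  refine (hgc.tendsto.mono_left nhdsWithin_le_nhds).congr' ?_
  filter_upwards [self_mem_nhdsWithin] with t ht
  have ht : t ≠ 0 := ht
  simp [slope_def_field, ht]

end

end DIP
end

section
/- Assume G and the subgraph G_I induced on the interior nodes are connected. Let γ ∈ ℂ_0^E satisfy P(γ,γ) = ℂ^E and let δγ ∈ ℂ^E. Then both of the following sets are finite: (i) {t ∈ ℂ : γ + tδγ ∈ ℂ_0^E and P(γ + tδγ, γ + tδγ) ≠ ℂ^E}; (ii) {t ∈ ℂ : γ + tδγ ∈ ℂ_0^E and P(γ, γ + tδγ) ≠ ℂ^E}. -/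
/-!
Common setup: a finite graph whose vertex set is partitioned into boundary
nodes `B` and interior nodes `I` (so the vertex set is `B ⊕ I`), with edge
set `E` and a fixed orientation given by maps `head tail : E → B ⊕ I`.
-/

open Matrix MeasureTheory

namespace DIP

noncomputable section

variable {B I E : Type*} [Fintype B] [Fintype I] [Fintype E]
  [DecidableEq B] [DecidableEq I] [DecidableEq E]

section Aux
variable {B I E : Type*} [Fintype B] [Fintype I] [Fintype E]
  [DecidableEq B] [DecidableEq I] [DecidableEq E]

def Wm (α : Type*) [CommRing α] (head tail : E → B ⊕ I) (γ : E → α) : Matrix (B ⊕ I) B α :=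
  Matrix.of (Sum.elim (fun b i => if b = i then (lapII α head tail γ).det else 0)
    (fun j i => -(((lapII α head tail γ).adjugate * lapIB α head tail γ) j i)))

def Fm (α : Type*) [CommRing α] (head tail : E → B ⊕ I) (γ₁ γ₂ : E → α) : Matrix E (B × B) α :=
  Matrix.of fun e p =>
    (Wm α head tail γ₁ (head e) p.1 - Wm α head tail γ₁ (tail e) p.1) *
    (Wm α head tail γ₂ (head e) p.2 - Wm α head tail γ₂ (tail e) p.2)

lemma incMat_map {α β : Type*} [CommRing α] [CommRing β] (f : α →+* β) (head tail : E → B ⊕ I) :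
    (incMat α head tail).map f = incMat β head tail := by
  ext e v
  simp only [incMat, Matrix.map_apply, Matrix.of_apply, map_sub]
  split_ifs <;> simp

lemma lap_map {α β : Type*} [CommRing α] [CommRing β] (f : α →+* β) (head tail : E → B ⊕ I)
    (γ : E → α) : (lap α head tail γ).map f = lap β head tail (fun e => f (γ e)) := by
  simp only [lap]
  rw [Matrix.map_mul, Matrix.map_mul, Matrix.transpose_map, incMat_map,
    Matrix.diagonal_map (map_zero f)]

lemma lapII_map {α β : Type*} [CommRing α] [CommRing β] (f : α →+* β) (head tail : E → B ⊕ I)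
    (γ : E → α) : (lapII α head tail γ).map f = lapII β head tail (fun e => f (γ e)) := by
  simp only [lapII, ← lap_map, Matrix.submatrix_map]

lemma lapIB_map {α β : Type*} [CommRing α] [CommRing β] (f : α →+* β) (head tail : E → B ⊕ I)
    (γ : E → α) : (lapIB α head tail γ).map f = lapIB β head tail (fun e => f (γ e)) := by
  simp only [lapIB, ← lap_map, Matrix.submatrix_map]

lemma Wm_map {α β : Type*} [CommRing α] [CommRing β] (f : α →+* β) (head tail : E → B ⊕ I)
    (γ : E → α) (v b) : f (Wm α head tail γ v b) = Wm β head tail (fun e => f (γ e)) v b := by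
  rcases v with c | j
  · simp only [Wm, Matrix.of_apply, Sum.elim_inl, ← lapII_map]
    split_ifs
    · rw [RingHom.map_det]; rfl
    · simp
  · simp only [Wm, Matrix.of_apply, Sum.elim_inr, ← lapII_map, ← lapIB_map, map_neg]
    have := RingHom.map_adjugate f (lapII α head tail γ)
    simp only [RingHom.mapMatrix_apply] at this
    rw [← this, ← Matrix.map_mul]
    rfl

lemma Fm_map {α β : Type*} [CommRing α] [CommRing β] (f : α →+* β) (head tail : E → B ⊕ I)
    (γ₁ γ₂ : E → α) : (Fm α head tail γ₁ γ₂).map f =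
      Fm β head tail (fun e => f (γ₁ e)) (fun e => f (γ₂ e)) := by
  ext e p
  simp only [Fm, Matrix.map_apply, Matrix.of_apply, map_mul, map_sub, Wm_map]

lemma Wm_harm (head tail : E → B ⊕ I) (γ : E → ℂ) (b : B) :
    Harmonic head tail γ 0 (fun v => Wm ℂ head tail γ v b) := by
  intro i
  simp only [Pi.zero_apply, zero_mul, add_zero, Matrix.mulVec, dotProduct, Fintype.sum_sum_type]
  have h1 : ∑ j, lap ℂ head tail γ (Sum.inr i) (Sum.inr j) * Wm ℂ head tail γ (Sum.inr j) b
      = -((lapII ℂ head tail γ * ((lapII ℂ head tail γ).adjugate * lapIB ℂ head tail γ)) i b) := by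
    rw [Matrix.mul_apply, ← Finset.sum_neg_distrib]
    refine Finset.sum_congr rfl fun j _ => ?_
    simp [Wm, lapII]
  rw [h1, ← Matrix.mul_assoc, Matrix.mul_adjugate]
  simp [Wm, lapIB, mul_comm]

lemma harm_zero (head tail : E → B ⊕ I) (γ : E → ℂ) (hd : (lapII ℂ head tail γ).det ≠ 0)
    (u : B ⊕ I → ℂ) (hu : Harmonic head tail γ 0 u) (hb : ∀ b, u (Sum.inl b) = 0) : u = 0 := by
  have h : (lapII ℂ head tail γ).mulVec (fun j => u (Sum.inr j)) = 0 := by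
    ext i
    have := hu i
    simpa [Matrix.mulVec, dotProduct, Fintype.sum_sum_type, hb, lapII] using this
  have h2 := Matrix.eq_zero_of_mulVec_eq_zero hd h
  ext v
  rcases v with b | j
  · exact hb b
  · exact congrFun h2 j

lemma harm_repr (head tail : E → B ⊕ I) (γ : E → ℂ) (hd : (lapII ℂ head tail γ).det ≠ 0)
    (u : B ⊕ I → ℂ) (hu : Harmonic head tail γ 0 u) :
    ∃ c : B → ℂ, ∀ v, u v = ∑ b, c b * Wm ℂ head tail γ v b := by
  refine ⟨fun b => u (Sum.inl b) / (lapII ℂ head tail γ).det, ?_⟩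
  set c : B → ℂ := fun b => u (Sum.inl b) / (lapII ℂ head tail γ).det with hc
  have key : u - (Wm ℂ head tail γ).mulVec c = 0 := by
    apply harm_zero head tail γ hd
    · intro i
      have h1 := hu i
      simp only [Pi.zero_apply, zero_mul, add_zero] at h1 ⊢
      rw [Matrix.mulVec_sub, Pi.sub_apply, h1, Matrix.mulVec_mulVec]
      have h2 : ∀ b, (lap ℂ head tail γ * Wm ℂ head tail γ) (Sum.inr i) b = 0 := by
        intro b
        have := Wm_harm head tail γ b i
        simpa [Matrix.mulVec, dotProduct, Matrix.mul_apply] using this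
      simp [Matrix.mulVec, dotProduct, h2]
    · intro b
      simp [Matrix.mulVec, dotProduct, Wm, hc]
      field_simp
      simp
  intro v
  have := congrFun key v
  simp only [Pi.sub_apply, Pi.zero_apply, sub_eq_zero] at this
  rw [this]
  simp [Matrix.mulVec, dotProduct, mul_comm]

lemma lap_form (head tail : E → B ⊕ I) (γ : E → ℂ) (u : B ⊕ I → ℂ) :
    (star u) ⬝ᵥ (lap ℂ head tail γ).mulVec u
      = ∑ e, γ e * (Complex.normSq (grad head tail u e) : ℂ) := by
  have hg : ∀ w : B ⊕ I → ℂ, (incMat ℂ head tail).mulVec w = grad head tail w := by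
    intro w; ext e
    simp [Matrix.mulVec, dotProduct, incMat, grad, sub_mul, Finset.sum_sub_distrib, -Fintype.sum_sum_type]
  rw [lap, Matrix.mul_assoc, ← Matrix.mulVec_mulVec, ← Matrix.mulVec_mulVec,
    Matrix.dotProduct_mulVec, Matrix.vecMul_transpose, hg, hg]
  simp only [dotProduct, Matrix.mulVec_diagonal]
  refine Finset.sum_congr rfl fun e _ => ?_
  rw [Complex.normSq_eq_conj_mul_self]
  simp [grad]
  ring

lemma det_ne [Nonempty B] (head tail : E → B ⊕ I) (hG : Gconn head tail)
    (γ : E → ℂ) (hγ : ∀ e, 0 < (γ e).re) : (lapII ℂ head tail γ).det ≠ 0 := by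
  intro h0
  obtain ⟨x, hx, hAx⟩ := Matrix.exists_mulVec_eq_zero_iff.mpr h0
  set u : B ⊕ I → ℂ := Sum.elim (fun _ => 0) x with hu
  have hf := lap_form head tail γ u
  have h1 : (star u) ⬝ᵥ (lap ℂ head tail γ).mulVec u = 0 := by
    simp only [dotProduct, Fintype.sum_sum_type]
    have : ∀ j, (lap ℂ head tail γ).mulVec u (Sum.inr j) = 0 := by
      intro j
      have := congrFun hAx j
      simpa [Matrix.mulVec, dotProduct, Fintype.sum_sum_type, hu, lapII] using this
    simp only [this, mul_zero, Finset.sum_const_zero, add_zero]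
    simp [hu]
  rw [h1] at hf
  have h2 : ∑ e, (γ e).re * Complex.normSq (grad head tail u e) = 0 := by
    have := congrArg Complex.re hf
    simpa [Complex.re_sum] using this.symm
  have h3 : ∀ e, grad head tail u e = 0 := by
    intro e
    have := (Finset.sum_eq_zero_iff_of_nonneg (fun e _ =>
      mul_nonneg (hγ e).le (Complex.normSq_nonneg _))).mp h2 e (Finset.mem_univ e)
    rcases mul_eq_zero.mp this with h | h
    · exact absurd h (hγ e).ne'
    · exact Complex.normSq_eq_zero.mp h
  have hstep : ∀ v w, (SimpleGraph.fromRel fun v w : B ⊕ I => ∃ e, head e = v ∧ tail e = w).Adj v w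
      → u v = u w := by
    intro v w h
    rw [SimpleGraph.fromRel_adj] at h
    rcases h.2 with ⟨e, rfl, rfl⟩ | ⟨e, rfl, rfl⟩
    · exact sub_eq_zero.mp (h3 e)
    · exact (sub_eq_zero.mp (h3 e)).symm
  have hall : ∀ v w, u v = u w := by
    intro v w
    obtain ⟨p⟩ := hG.preconnected v w
    induction p with
    | nil => rfl
    | cons h _ ih => exact (hstep _ _ h).trans ih
  apply hx
  ext i
  have := hall (Sum.inr i) (Sum.inl (Classical.arbitrary B))
  simpa [hu] using this

lemma P_top_imp (head tail : E → B ⊕ I) (γ₁ γ₂ : E → ℂ) (h1 : (lapII ℂ head tail γ₁).det ≠ 0)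
    (h2 : (lapII ℂ head tail γ₂).det ≠ 0) (hP : Pspace head tail γ₁ γ₂ = ⊤) :
    Function.Surjective (Fm ℂ head tail γ₁ γ₂).mulVec := by
  have : Pspace head tail γ₁ γ₂ ≤ LinearMap.range (Fm ℂ head tail γ₁ γ₂).mulVecLin := by
    rw [Pspace, Submodule.span_le]
    rintro w ⟨u, v, hu, hv, rfl⟩
    obtain ⟨c, hc⟩ := harm_repr head tail γ₁ h1 u hu
    obtain ⟨d, hd⟩ := harm_repr head tail γ₂ h2 v hv
    refine ⟨fun p => c p.1 * d p.2, ?_⟩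
    ext e
    simp only [Matrix.mulVecLin_apply, Matrix.mulVec, dotProduct, grad, hc, hd, Fm, Matrix.of_apply,
      ← Finset.sum_sub_distrib, Finset.sum_mul_sum, Fintype.sum_prod_type]
    refine Finset.sum_congr rfl fun b _ => Finset.sum_congr rfl fun b' _ => ?_
    ring
  rw [hP, top_le_iff, LinearMap.range_eq_top] at this
  exact this

lemma P_top_of (head tail : E → B ⊕ I) (γ₁ γ₂ : E → ℂ)
    (hs : Function.Surjective (Fm ℂ head tail γ₁ γ₂).mulVec) : Pspace head tail γ₁ γ₂ = ⊤ := by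
  rw [eq_top_iff]
  intro w _
  obtain ⟨c, rfl⟩ := hs w
  have : (Fm ℂ head tail γ₁ γ₂).mulVec c = ∑ p, c p • (fun e => Fm ℂ head tail γ₁ γ₂ e p) := by
    ext e
    simp [Matrix.mulVec, dotProduct, mul_comm]
  rw [this]
  refine Submodule.sum_mem _ fun p _ => Submodule.smul_mem _ _ (Submodule.subset_span ?_)
  exact ⟨_, _, Wm_harm head tail γ₁ p.1, Wm_harm head tail γ₂ p.2, rfl⟩

open Polynomial in
lemma fin_bad [Nonempty B] (head tail : E → B ⊕ I) (hG : Gconn head tail)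
    (γ : E → ℂ) (hγ : ∀ e, 0 < (γ e).re) (hP : Pspace head tail γ γ = ⊤)
    (p₁ p₂ : E → ℂ[X]) (h1 : ∀ e, (p₁ e).eval 0 = γ e) (h2 : ∀ e, (p₂ e).eval 0 = γ e) :
    { t : ℂ | Pspace head tail (fun e => (p₁ e).eval t) (fun e => (p₂ e).eval t) ≠ ⊤ }.Finite := by
  have hd := det_ne head tail hG γ hγ
  obtain ⟨R, hR⟩ := Matrix.mulVec_surjective_iff_exists_right_inverse.mp
    (P_top_imp head tail γ γ hd hd hP)
  let D : ℂ[X] := (Fm ℂ[X] head tail p₁ p₂ * R.map C).det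
  have hD : ∀ t, D.eval t = (Fm ℂ head tail (fun e => (p₁ e).eval t)
      (fun e => (p₂ e).eval t) * R).det := by
    intro t
    have hm := Fm_map (evalRingHom t) head tail p₁ p₂
    simp only [coe_evalRingHom] at hm
    rw [← coe_evalRingHom, RingHom.map_det, RingHom.mapMatrix_apply, Matrix.map_mul, coe_evalRingHom, hm]
    congr 2
    ext a b
    simp
  have hD0 : D ≠ 0 := by
    intro h
    have := hD 0
    simp only [h, eval_zero, h1, h2] at this
    rw [hR] at this
    simp at this
  refine (Polynomial.finite_setOfPred_isRoot hD0).subset ?_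
  intro t ht
  by_contra hne
  apply ht
  apply P_top_of
  have hu : IsUnit (Fm ℂ head tail (fun e => (p₁ e).eval t) (fun e => (p₂ e).eval t) * R).det := by
    rw [← hD]; exact isUnit_iff_ne_zero.mpr hne
  rw [Matrix.mulVec_surjective_iff_exists_right_inverse]
  refine ⟨R * (Fm ℂ head tail (fun e => (p₁ e).eval t) (fun e => (p₂ e).eval t) * R)⁻¹, ?_⟩
  rw [← Matrix.mul_assoc, Matrix.mul_nonsing_inv _ hu]

end Aux

/-- along any direction `δγ` there are at most finitely many
`t ∈ ℂ` with `γ + tδγ ∈ ℂ_0^E` for which (i) the linearized problem is not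
solvable at `γ + tδγ`, or (ii) `P(γ, γ + tδγ) ≠ ℂ^E`. -/
theorem finitely_many_bad_cond [Nonempty B] (head tail : E → B ⊕ I)
    (hG : Gconn head tail) (hGI : GIconn head tail)
    (γ : E → ℂ) (hγ : ∀ e, 0 < (γ e).re) (hP : Pspace head tail γ γ = ⊤)
    (δγ : E → ℂ) :
    { t : ℂ | (∀ e, 0 < (γ e + t * δγ e).re) ∧
        Pspace head tail (fun e => γ e + t * δγ e) (fun e => γ e + t * δγ e) ≠ ⊤ }.Finite ∧
    { t : ℂ | (∀ e, 0 < (γ e + t * δγ e).re) ∧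
        Pspace head tail γ (fun e => γ e + t * δγ e) ≠ ⊤ }.Finite := by
  refine ⟨?_, ?_⟩
  · refine (fin_bad head tail hG γ hγ hP
      (fun e => Polynomial.C (γ e) + Polynomial.X * Polynomial.C (δγ e))
      (fun e => Polynomial.C (γ e) + Polynomial.X * Polynomial.C (δγ e))
      (by simp) (by simp)).subset ?_
    rintro t ⟨_, ht⟩
    simp only [Set.mem_setOf_eq, Polynomial.eval_add, Polynomial.eval_mul, Polynomial.eval_C,
      Polynomial.eval_X]
    exact ht
  · refine (fin_bad head tail hG γ hγ hP
      (fun e => Polynomial.C (γ e))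
      (fun e => Polynomial.C (γ e) + Polynomial.X * Polynomial.C (δγ e))
      (by simp) (by simp)).subset ?_
    rintro t ⟨_, ht⟩
    simp only [Set.mem_setOf_eq, Polynomial.eval_add, Polynomial.eval_mul, Polynomial.eval_C,
      Polynomial.eval_X]
    exact ht

end

end DIP
end
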